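/- There is a constant C_k > 0 depending only on k such that the following holds in the setting of the long code test 𝒯₂. For γ ∈ (0, 1) and a family {f_v : {−1,1}^{2R} → {−1,1}}_{v∈V}, define τ_{u,v,w} := Σ_{i∈[L]} Inf̄ᵘ_i[T_{1−γ} f_v] · Inf̄ᵘ_i[T_{1−γ} f_w]. Then E_{u,v,w} | E_{𝒯₂}[ Π_{j=1}^k (T_{1−γ} f_v)(x_j) (T_{1−γ} f_w)(y_j) ] − E_{𝒯₂}[ Π_{j=1}^k (T_{1−γ} f_v)(x_j) ] · E_{𝒯₂}[ Π_{j=1}^k (T_{1−γ} f_w)(y_j) ] | ≤ C_k · sqrt( E_{u,v,w}[τ_{u,v,w}] / γ ). -/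

import Mathlib

open Finset

/-! Common setup for the long code test `𝒯₂` of Dinur–Kol / this paper.

A Label-Cover instance consists of a bipartite graph on `U × V` given by a Boolean
adjacency relation `Adj`, with projections `π u v : Fin R → Fin L`; we assume `R = d·L`
and that all fibers `π_{uv}^{-1}(i)` have size `d`.  Long-code strings in `{0,1}^{2R}`
are indexed by `Fin R ⊕ Fin R` (`Sum.inl j` is position `j ∈ [R]`, `Sum.inr j` is
position `j + R`). -/

/-- Choose `P1` if `b = true`, else `P0`. -/
def pick {k : ℕ} (P0 P1 : (Fin k → Bool) → ℝ) (b : Bool) : (Fin k → Bool) → ℝ :=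
  if b = true then P1 else P0

/-- The fiber `π_{uv}^{-1}(i) ⊆ [R]`. -/
def fib {U V : Type} {L R : ℕ} (π : U → V → Fin R → Fin L) (u : U) (v : V) (i : Fin L) :
    Finset (Fin R) :=
  univ.filter (fun j => π u v j = i)

/-- Mass contributed by block `i ∈ [L]` of the test `𝒯₂` for fixed `u, v, w`:
a uniform bit `c₁` decides whether the `X`-columns of the block (of both halves,
`B_{uv}(i)` and `B'_{uv}(i)`) are i.i.d. `𝒫₀` and the `Y`-columns i.i.d. `𝒫₁`, or vice
versa; then independently with probability `1 − 2ε` nothing is changed, with probability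
`ε` the primed halves `(X|_{B'_{uv}(i)}, Y|_{B'_{uw}(i)})` are resampled uniformly, and
with probability `ε` the unprimed halves are resampled uniformly. -/
noncomputable def blockM {U V : Type} {k L R : ℕ} (π : U → V → Fin R → Fin L)
    (ε : ℝ) (P0 P1 : (Fin k → Bool) → ℝ) (d : ℕ) (u : U) (v w : V) (i : Fin L)
    (X Y : Fin k → (Fin R ⊕ Fin R) → Bool) : ℝ :=
  (1 / 2) * ∑ b : Bool,
    ((1 - 2 * ε) *
        ((∏ j ∈ fib π u v i,
            pick P0 P1 b (fun r => X r (Sum.inl j)) * pick P0 P1 b (fun r => X r (Sum.inr j))) *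
         (∏ j ∈ fib π u w i,
            pick P0 P1 (!b) (fun r => Y r (Sum.inl j)) * pick P0 P1 (!b) (fun r => Y r (Sum.inr j))))
     + ε * ((∏ j ∈ fib π u v i, pick P0 P1 b (fun r => X r (Sum.inl j))) *
            (∏ j ∈ fib π u w i, pick P0 P1 (!b) (fun r => Y r (Sum.inl j)))) *
          ((1 : ℝ) / 2 ^ k) ^ (2 * d)
     + ε * ((∏ j ∈ fib π u v i, pick P0 P1 b (fun r => X r (Sum.inr j))) *
            (∏ j ∈ fib π u w i, pick P0 P1 (!b) (fun r => Y r (Sum.inr j)))) *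
          ((1 : ℝ) / 2 ^ k) ^ (2 * d))

/-- Mass of the pair of matrices `(X, Y)` under the test `𝒯₂` for fixed `u, v, w`:
the blocks `i ∈ [L]` are independent. -/
noncomputable def massT2 {U V : Type} {k L R : ℕ} (π : U → V → Fin R → Fin L)
    (ε : ℝ) (P0 P1 : (Fin k → Bool) → ℝ) (d : ℕ) (u : U) (v w : V)
    (X Y : Fin k → (Fin R ⊕ Fin R) → Bool) : ℝ :=
  ∏ i : Fin L, blockM π ε P0 P1 d u v w i X Y

/-- Expectation over `(X, Y) ∼ 𝒯₂` (for fixed `u, v, w`) of a function of the two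
matrices. -/
noncomputable def ET2 {U V : Type} {k L R : ℕ} (π : U → V → Fin R → Fin L)
    (ε : ℝ) (P0 P1 : (Fin k → Bool) → ℝ) (d : ℕ) (u : U) (v w : V)
    (h : (Fin k → (Fin R ⊕ Fin R) → Bool) → (Fin k → (Fin R ⊕ Fin R) → Bool) → ℝ) : ℝ :=
  ∑ X : Fin k → (Fin R ⊕ Fin R) → Bool, ∑ Y : Fin k → (Fin R ⊕ Fin R) → Bool,
    massT2 π ε P0 P1 d u v w X Y * h X Y

/-- The neighbors of `u ∈ U` in the bipartite graph. -/
def nbr {U V : Type} [Fintype V] (Adj : U → V → Bool) (u : U) : Finset V :=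
  univ.filter (fun v => Adj u v = true)

/-- Expectation over a uniform `u ∈ U` and uniform independent neighbors `v, w` of `u`. -/
noncomputable def Euvw {U V : Type} [Fintype U] [Fintype V] (Adj : U → V → Bool)
    (h : U → V → V → ℝ) : ℝ :=
  (1 / (Fintype.card U : ℝ)) * ∑ u : U, (1 / ((nbr Adj u).card : ℝ) ^ 2) *
    ∑ v ∈ nbr Adj u, ∑ w ∈ nbr Adj u, h u v w

/-- The Fourier character `χ_β` on `{0,1}^{2R}` (bits identified with `±1`). -/
def chi {R : ℕ} (β : Finset (Fin R ⊕ Fin R)) (x : (Fin R ⊕ Fin R) → Bool) : ℝ :=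
  ∏ c ∈ β, (if x c = true then (-1 : ℝ) else 1)

/-- The Fourier coefficient `f̂(β)` of `f : {0,1}^{2R} → ℝ` over the uniform
distribution. -/
noncomputable def fhat {R : ℕ} (f : ((Fin R ⊕ Fin R) → Bool) → ℝ)
    (β : Finset (Fin R ⊕ Fin R)) : ℝ :=
  (∑ x : (Fin R ⊕ Fin R) → Bool, f x * chi β x) / (2 : ℝ) ^ (2 * R)

/-- The noise operator `T_{1-γ} f = Σ_β (1-γ)^{|β|} f̂(β) χ_β`. -/
noncomputable def noiseT {R : ℕ} (γ : ℝ) (f : ((Fin R ⊕ Fin R) → Bool) → ℝ) :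
    ((Fin R ⊕ Fin R) → Bool) → ℝ :=
  fun x => ∑ β : Finset (Fin R ⊕ Fin R), (1 - γ) ^ β.card * fhat f β * chi β x

/-- `π̃_{uv}(β) := {i ∈ [L] : ∃ j ∈ [R], (j ∈ β ∨ j + R ∈ β) ∧ π_{uv}(j) = i}`. -/
def ptil {U V : Type} {L R : ℕ} (π : U → V → Fin R → Fin L) (u : U) (v : V)
    (β : Finset (Fin R ⊕ Fin R)) : Finset (Fin L) :=
  univ.filter (fun i => ∃ j : Fin R, (Sum.inl j ∈ β ∨ Sum.inr j ∈ β) ∧ π u v j = i)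

/-- The grouped influence `Inf̄ᵘ_i[f] = Σ_{α : i ∈ π̃_{uv}(α)} f̂(α)²`. -/
noncomputable def gInf {U V : Type} {L R : ℕ} (π : U → V → Fin R → Fin L) (u : U) (v : V)
    (f : ((Fin R ⊕ Fin R) → Bool) → ℝ) (i : Fin L) : ℝ :=
  ∑ β ∈ univ.filter (fun β : Finset (Fin R ⊕ Fin R) => i ∈ ptil π u v β), (fhat f β) ^ 2

/-! ### Matrices with independent columns -/

/-- A product of sums over a finite type expands as a sum over choice functions. -/
theorem prod_sum_eq_sum_prod {ι κ : Type*} [Fintype ι] [DecidableEq ι] [Fintype κ]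
    (f : ι → κ → ℝ) : ∏ i, ∑ j, f i j = ∑ x : ι → κ, ∏ i, f i (x i) := by
  rw [Finset.prod_univ_sum, Fintype.piFinset_univ]

/-- Sum of `h` against the product weight with factors `D e`. -/
def colExp {ι κ : Type*} [Fintype ι] [DecidableEq ι] [Fintype κ] (D : ι → κ → ℝ)
    (h : (ι → κ) → ℝ) : ℝ :=
  ∑ Z : ι → κ, (∏ e, D e (Z e)) * h Z

section colExp

variable {ι κ : Type*} [Fintype ι] [DecidableEq ι] [Fintype κ]

theorem colExp_sum {α : Type*} (D : ι → κ → ℝ) (s : Finset α) (g : α → (ι → κ) → ℝ) :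
    colExp D (fun Z => ∑ a ∈ s, g a Z) = ∑ a ∈ s, colExp D (g a) := by
  simp only [colExp, mul_sum]
  exact sum_comm

theorem colExp_const_mul (D : ι → κ → ℝ) (c : ℝ) (g : (ι → κ) → ℝ) :
    colExp D (fun Z => c * g Z) = c * colExp D g := by
  simp only [colExp, mul_sum]
  exact sum_congr rfl fun _ _ => by ring

theorem abs_colExp_le {D : ι → κ → ℝ} (hD : ∀ e z, 0 ≤ D e z) {g h : (ι → κ) → ℝ}
    (hgh : ∀ Z, |g Z| ≤ h Z) : |colExp D g| ≤ colExp D h := by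
  refine (abs_sum_le_sum_abs _ _).trans (sum_le_sum fun Z _ => ?_)
  have h0 : 0 ≤ ∏ e, D e (Z e) := prod_nonneg fun e _ => hD e _
  rw [abs_mul, abs_of_nonneg h0]
  exact mul_le_mul_of_nonneg_left (hgh Z) h0

theorem colExp_const {D : ι → κ → ℝ} (hD : ∀ e, ∑ z, D e z = 1) (c : ℝ) :
    colExp D (fun _ => c) = c := by
  simp [colExp, ← sum_mul, ← prod_sum_eq_sum_prod, hD]

/-- Columns on which `h` does not depend can be summed out. -/
theorem colExp_of_dependsOn (D : ι → κ → ℝ) (B : Finset ι) (z0 : κ) {h : (ι → κ) → ℝ}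
    (hh : DependsOn h ((B : Set ι)ᶜ)) :
    colExp D h = (∏ e ∈ B, ∑ z, D e z) *
      ∑ Z : {e // e ∉ B} → κ, (∏ e : {e // e ∉ B}, D e (Z e)) *
        h (fun e => if he : e ∈ B then z0 else Z ⟨e, he⟩) := by
  unfold colExp
  rw [← (Equiv.piEquivPiSubtypeProd (· ∈ B) (fun _ => κ)).symm.sum_comp, Fintype.sum_prod_type,
    ← prod_coe_sort, prod_sum_eq_sum_prod, sum_mul_sum]
  refine sum_congr rfl fun Z1 _ => sum_congr rfl fun Z2 _ => ?_
  rw [← Fintype.prod_subtype_mul_prod_subtype (· ∈ B), ← mul_assoc]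
  congr 1
  · congr 1
    · exact prod_congr (by ext; simp) fun e _ => by simp [Equiv.piEquivPiSubtypeProd]
    · exact prod_congr rfl fun e _ => by simp [Equiv.piEquivPiSubtypeProd, e.2]
  · refine hh fun e he => ?_
    have he' : e ∉ B := by simpa using he
    simp [Equiv.piEquivPiSubtypeProd, he']

theorem colExp_congr_of_dependsOn {D D' : ι → κ → ℝ} (hD : ∀ e, ∑ z, D e z = 1)
    (hD' : ∀ e, ∑ z, D' e z = 1) (B : Finset ι) [Nonempty κ] (hDD' : ∀ e ∉ B, D e = D' e)
    {h : (ι → κ) → ℝ} (hh : DependsOn h ((B : Set ι)ᶜ)) : colExp D h = colExp D' h := by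
  obtain ⟨z0⟩ := ‹Nonempty κ›
  rw [colExp_of_dependsOn D B z0 hh, colExp_of_dependsOn D' B z0 hh]
  congr 1
  · simp [hD, hD']
  · exact sum_congr rfl fun Z _ => by
      congr 1
      exact prod_congr rfl fun e _ => by rw [hDD' e e.2]

/-- A factor depending on a single column only, with mean zero, kills the expectation. -/
theorem colExp_mul_eq_zero [Nonempty κ] {D : ι → κ → ℝ} (e0 : ι) (φ : κ → ℝ)
    (hφ : ∑ z, D e0 z * φ z = 0) {h : (ι → κ) → ℝ} (hh : DependsOn h ({e0} : Set ι)ᶜ) :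
    colExp D (fun Z => φ (Z e0) * h Z) = 0 := by
  obtain ⟨z0⟩ := ‹Nonempty κ›
  have key : colExp D (fun Z => φ (Z e0) * h Z) =
      colExp (Function.update D e0 fun z => D e0 z * φ z) h := by
    refine sum_congr rfl fun Z _ => ?_
    rw [← mul_assoc, ← mul_prod_erase univ _ (mem_univ e0),
      ← mul_prod_erase univ (fun e => Function.update D e0 (fun z => D e0 z * φ z) e (Z e))
        (mem_univ e0)]
    have : ∏ e ∈ univ.erase e0, Function.update D e0 (fun z => D e0 z * φ z) e (Z e) =
        ∏ e ∈ univ.erase e0, D e (Z e) :=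
      prod_congr rfl fun e he => by rw [Function.update_of_ne (ne_of_mem_erase he)]
    rw [this, Function.update_self]
    ring
  rw [key, colExp_of_dependsOn _ {e0} z0 (by simpa using hh)]
  simp [hφ]

end colExp

section rows

variable {ι : Type*} [Fintype ι] [DecidableEq ι] {k : ℕ}

/-- `D` is a probability weight on `{0,1}^k` all of whose coordinates are uniform. -/
structure UnifMarg (D : (Fin k → Bool) → ℝ) : Prop where
  nonneg : ∀ z, 0 ≤ D z
  sum_eq_one : ∑ z, D z = 1
  marg : ∀ (j : Fin k) (b : Bool), ∑ z ∈ univ.filter (fun z : Fin k → Bool => z j = b), D z = 1 / 2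

theorem UnifMarg.sum_sign {D : (Fin k → Bool) → ℝ} (hD : UnifMarg D) (j : Fin k) :
    ∑ z, D z * (if z j = true then (-1 : ℝ) else 1) = 0 := by
  have h : ∀ z : Fin k → Bool, D z * (if z j = true then (-1 : ℝ) else 1) =
      (if z j = false then D z else 0) - (if z j = true then D z else 0) := by
    intro z
    cases z j <;> simp
  simp_rw [h, sum_sub_distrib, ← sum_filter, hD.marg, sub_self]

/-- Each row of a matrix with independent columns with uniform coordinates is uniform. -/
theorem colExp_row {D : ι → (Fin k → Bool) → ℝ} (hD : ∀ e, UnifMarg (D e)) (j : Fin k)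
    (g : (ι → Bool) → ℝ) :
    colExp D (fun Z => g fun e => Z e j) = (∑ x, g x) / 2 ^ Fintype.card ι := by
  have h1 : ∀ Z : ι → Fin k → Bool, g (fun e => Z e j) =
      ∑ x : ι → Bool, g x * ∏ e, (if Z e j = x e then (1 : ℝ) else 0) := by
    intro Z
    rw [sum_eq_single (fun e => Z e j)]
    · simp
    · intro x _ hx
      obtain ⟨e, he⟩ := Function.ne_iff.1 hx
      rw [prod_eq_zero (mem_univ e), mul_zero]
      simp [Ne.symm he]
    · simp
  have h2 : ∀ x : ι → Bool, colExp D
      (fun Z => ∏ e, (if Z e j = x e then (1 : ℝ) else 0)) = (1 / 2) ^ Fintype.card ι := by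
    intro x
    simp_rw [colExp, ← prod_mul_distrib]
    rw [← prod_sum_eq_sum_prod (fun e z => D e z * (if z j = x e then (1 : ℝ) else 0))]
    simp_rw [mul_ite, mul_one, mul_zero, ← sum_filter, (hD _).marg]
    simp
  simp_rw [h1, colExp_sum, colExp_const_mul, h2, ← sum_mul]
  simp [div_eq_mul_inv]

end rows

/-! ### Fourier analysis on `{0,1}^{2R}` -/

section fourier

variable {R : ℕ}

theorem chi_eq_prod_ite (β : Finset (Fin R ⊕ Fin R)) (x : Fin R ⊕ Fin R → Bool) :
    chi β x = ∏ c, if c ∈ β then (if x c = true then (-1 : ℝ) else 1) else 1 := by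
  rw [chi, prod_ite_mem, univ_inter]

theorem sum_chi_mul_chi (α β : Finset (Fin R ⊕ Fin R)) :
    ∑ x, chi α x * chi β x = if α = β then (2 : ℝ) ^ (2 * R) else 0 := by
  simp_rw [chi_eq_prod_ite, ← prod_mul_distrib]
  rw [← prod_sum_eq_sum_prod (fun c b =>
    (if c ∈ α then (if b = true then (-1 : ℝ) else 1) else 1) *
      (if c ∈ β then (if b = true then (-1 : ℝ) else 1) else 1))]
  split_ifs with h
  · subst h
    have : ∀ c, ∑ b : Bool, (if c ∈ α then (if b = true then (-1 : ℝ) else 1) else 1) *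
        (if c ∈ α then (if b = true then (-1 : ℝ) else 1) else 1) = 2 := by
      intro c
      by_cases hc : c ∈ α <;> (simp [hc]; try norm_num)
    simp_rw [this]
    simp [two_mul]
  · obtain ⟨c, hc⟩ : ∃ c, ¬(c ∈ α ↔ c ∈ β) := by
      by_contra! hcon
      exact h (Finset.ext hcon)
    refine prod_eq_zero (mem_univ c) ?_
    by_cases h1 : c ∈ α <;> by_cases h2 : c ∈ β <;> simp_all

theorem fhat_sum_chi (a : Finset (Fin R ⊕ Fin R) → ℝ) (α : Finset (Fin R ⊕ Fin R)) :
    fhat (fun x => ∑ β, a β * chi β x) α = a α := by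
  simp_rw [fhat, sum_mul, mul_assoc]
  rw [sum_comm]
  simp_rw [← mul_sum, sum_chi_mul_chi]
  simp

theorem parseval_sum_chi (a : Finset (Fin R ⊕ Fin R) → ℝ) :
    (∑ x, (∑ β, a β * chi β x) ^ 2) / 2 ^ (2 * R) = ∑ β, a β ^ 2 := by
  have h : ∀ x, (∑ β, a β * chi β x) ^ 2 = ∑ α, a α * ((∑ β, a β * chi β x) * chi α x) := by
    intro x
    rw [sq, mul_comm, sum_mul]
    exact sum_congr rfl fun _ _ => by ring
  simp_rw [h]
  rw [sum_comm, sum_div]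
  refine sum_congr rfl fun α _ => ?_
  rw [← mul_sum, mul_div_assoc, sq]
  congr 1
  exact fhat_sum_chi a α

/-- The noise operator with coordinate-dependent correlation `ρ`. -/
noncomputable def mnoise (ρ : Fin R ⊕ Fin R → ℝ) (f : (Fin R ⊕ Fin R → Bool) → ℝ) :
    (Fin R ⊕ Fin R → Bool) → ℝ :=
  fun x => ∑ β, (∏ c ∈ β, ρ c) * fhat f β * chi β x

theorem noiseT_eq_mnoise (γ : ℝ) (f : (Fin R ⊕ Fin R → Bool) → ℝ) :
    noiseT γ f = mnoise (fun _ => 1 - γ) f := by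
  funext x
  simp [noiseT, mnoise]

theorem mnoise_eq_sum_kernel (ρ : Fin R ⊕ Fin R → ℝ) (f : (Fin R ⊕ Fin R → Bool) → ℝ)
    (x : Fin R ⊕ Fin R → Bool) :
    mnoise ρ f x = (∑ y, f y * ∏ c, (1 + ρ c * ((if y c = true then (-1 : ℝ) else 1) *
      (if x c = true then (-1 : ℝ) else 1)))) / 2 ^ (2 * R) := by
  simp_rw [prod_one_add, powerset_univ, mul_sum, mnoise, fhat, chi, prod_mul_distrib]
  rw [sum_comm, sum_div]
  refine sum_congr rfl fun β _ => ?_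
  rw [mul_div_assoc', div_mul_eq_mul_div, mul_sum, sum_mul]
  congr 1
  exact sum_congr rfl fun y _ => by ring

theorem abs_mnoise_le_one {ρ : Fin R ⊕ Fin R → ℝ} (h0 : ∀ c, 0 ≤ ρ c) (h1 : ∀ c, ρ c ≤ 1)
    {f : (Fin R ⊕ Fin R → Bool) → ℝ} (hf : ∀ x, |f x| ≤ 1) (x : Fin R ⊕ Fin R → Bool) :
    |mnoise ρ f x| ≤ 1 := by
  rw [mnoise_eq_sum_kernel, abs_div, abs_of_pos (by positivity : (0 : ℝ) < 2 ^ (2 * R)),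
    div_le_one (by positivity)]
  calc _ ≤ ∑ y : Fin R ⊕ Fin R → Bool, ∏ c, (1 + ρ c * ((if y c = true then (-1 : ℝ) else 1) *
        (if x c = true then (-1 : ℝ) else 1))) := by
        refine (abs_sum_le_sum_abs _ _).trans (sum_le_sum fun y _ => ?_)
        have hp : 0 ≤ ∏ c, (1 + ρ c * ((if y c = true then (-1 : ℝ) else 1) *
            (if x c = true then (-1 : ℝ) else 1))) := by
          refine prod_nonneg fun c _ => ?_
          have := h0 c
          have := h1 c
          split_ifs <;> linarith
        rw [abs_mul, abs_of_nonneg hp]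
        exact mul_le_of_le_one_left hp (hf y)
    _ = 2 ^ (2 * R) := by
        rw [← prod_sum_eq_sum_prod (fun c b => 1 + ρ c * ((if b = true then (-1 : ℝ) else 1) *
          (if x c = true then (-1 : ℝ) else 1)))]
        have : ∀ c, ∑ b : Bool, (1 + ρ c * ((if b = true then (-1 : ℝ) else 1) *
            (if x c = true then (-1 : ℝ) else 1))) = 2 := by
          intro c
          cases x c <;> simp <;> ring
        simp_rw [this]
        simp [two_mul]

/-- The part of `T_{1-γ} f` supported on characters that avoid `B`. -/
noncomputable def offPart (γ : ℝ) (f : (Fin R ⊕ Fin R → Bool) → ℝ) (B : Finset (Fin R ⊕ Fin R)) :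
    (Fin R ⊕ Fin R → Bool) → ℝ :=
  mnoise (fun c => if c ∈ B then 0 else 1 - γ) f

/-- The part of `T_{1-γ} f` supported on characters that meet `B`. -/
noncomputable def onPart (γ : ℝ) (f : (Fin R ⊕ Fin R → Bool) → ℝ) (B : Finset (Fin R ⊕ Fin R)) :
    (Fin R ⊕ Fin R → Bool) → ℝ :=
  fun x => ∑ β, (if Disjoint β B then 0 else (1 - γ) ^ β.card * fhat f β) * chi β x

theorem prod_ite_mem_zero (B β : Finset (Fin R ⊕ Fin R)) (ρ : ℝ) :
    ∏ c ∈ β, (if c ∈ B then 0 else ρ) = if Disjoint β B then ρ ^ β.card else 0 := by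
  split_ifs with h
  · rw [← prod_const]
    exact prod_congr rfl fun c hc => if_neg (disjoint_left.1 h hc)
  · obtain ⟨c, hc, hcB⟩ := not_disjoint_iff.1 h
    exact prod_eq_zero hc (if_pos hcB)

theorem onPart_add_offPart (γ : ℝ) (f : (Fin R ⊕ Fin R → Bool) → ℝ)
    (B : Finset (Fin R ⊕ Fin R)) (x : Fin R ⊕ Fin R → Bool) :
    onPart γ f B x + offPart γ f B x = noiseT γ f x := by
  simp only [onPart, offPart, mnoise, noiseT, prod_ite_mem_zero]
  rw [← sum_add_distrib]
  refine sum_congr rfl fun β _ => ?_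
  split_ifs <;> ring

theorem offPart_dependsOn (γ : ℝ) (f : (Fin R ⊕ Fin R → Bool) → ℝ)
    (B : Finset (Fin R ⊕ Fin R)) : DependsOn (offPart γ f B) ((B : Set (Fin R ⊕ Fin R))ᶜ) := by
  intro x y hxy
  simp only [offPart, mnoise, prod_ite_mem_zero]
  refine sum_congr rfl fun β _ => ?_
  split_ifs with h
  · congr 1
    exact prod_congr rfl fun c hc => by rw [hxy c (by simpa using disjoint_left.1 h hc)]
  · simp

theorem fhat_noiseT (γ : ℝ) (f : (Fin R ⊕ Fin R → Bool) → ℝ) (β : Finset (Fin R ⊕ Fin R)) :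
    fhat (noiseT γ f) β = (1 - γ) ^ β.card * fhat f β :=
  fhat_sum_chi (fun β => (1 - γ) ^ β.card * fhat f β) β

theorem mean_onPart_sq (γ : ℝ) (f : (Fin R ⊕ Fin R → Bool) → ℝ)
    (B : Finset (Fin R ⊕ Fin R)) :
    (∑ x, onPart γ f B x ^ 2) / 2 ^ (2 * R) =
      ∑ β ∈ univ.filter (fun β => ¬Disjoint β B), fhat (noiseT γ f) β ^ 2 := by
  simp only [onPart]
  rw [parseval_sum_chi, sum_filter]
  refine sum_congr rfl fun β _ => ?_
  rw [fhat_noiseT]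
  split_ifs <;> simp

theorem abs_noiseT_le_one {γ : ℝ} (h0 : 0 < γ) (h1 : γ < 1) {f : (Fin R ⊕ Fin R → Bool) → ℝ}
    (hf : ∀ x, |f x| ≤ 1) (x : Fin R ⊕ Fin R → Bool) : |noiseT γ f x| ≤ 1 := by
  rw [noiseT_eq_mnoise]
  exact abs_mnoise_le_one (fun _ => by linarith) (fun _ => by linarith) hf x

theorem abs_offPart_le_one {γ : ℝ} (h0 : 0 < γ) (h1 : γ < 1) {f : (Fin R ⊕ Fin R → Bool) → ℝ}
    (hf : ∀ x, |f x| ≤ 1) (B : Finset (Fin R ⊕ Fin R)) (x : Fin R ⊕ Fin R → Bool) :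
    |offPart γ f B x| ≤ 1 := by
  refine abs_mnoise_le_one (fun c => ?_) (fun c => ?_) hf x <;> split_ifs <;> linarith

theorem abs_onPart_le_two {γ : ℝ} (h0 : 0 < γ) (h1 : γ < 1) {f : (Fin R ⊕ Fin R → Bool) → ℝ}
    (hf : ∀ x, |f x| ≤ 1) (B : Finset (Fin R ⊕ Fin R)) (x : Fin R ⊕ Fin R → Bool) :
    |onPart γ f B x| ≤ 2 := by
  have h2 := abs_noiseT_le_one h0 h1 hf x
  have h3 := abs_offPart_le_one h0 h1 hf B x
  rw [← onPart_add_offPart γ f B x] at h2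
  rw [abs_le] at *
  constructor <;> linarith

end fourier

/-! ### Rerandomizing a block of columns -/

theorem abs_prod_mul_prod_sdiff_le {k : ℕ} {p q : Fin k → ℝ} (hp : ∀ j, |p j| ≤ 1)
    (hq : ∀ j, |q j| ≤ 2) {S : Finset (Fin k)} (hS : 1 < S.card) :
    |(∏ j ∈ S, q j) * ∏ j ∈ univ \ S, p j| ≤ 2 ^ k * ∑ j, q j ^ 2 := by
  obtain ⟨a, ha, b, hb, hab⟩ := one_lt_card.1 hS
  have hb' : b ∈ S.erase a := mem_erase.2 ⟨hab.symm, hb⟩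
  have hle : ∀ j, |q j| ^ 2 ≤ ∑ j, q j ^ 2 := fun j => by
    rw [sq_abs]
    exact single_le_sum (f := fun j => q j ^ 2) (fun _ _ => sq_nonneg _) (mem_univ j)
  have h1 : ∏ j ∈ univ \ S, |p j| ≤ 1 := prod_le_one (fun _ _ => abs_nonneg _) fun j _ => hp j
  have h2 : ∏ j ∈ (S.erase a).erase b, |q j| ≤ 2 ^ k := by
    calc _ ≤ ∏ j ∈ (S.erase a).erase b, (2 : ℝ) :=
          prod_le_prod (fun _ _ => abs_nonneg _) fun j _ => hq j
      _ = 2 ^ ((S.erase a).erase b).card := prod_const _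
      _ ≤ 2 ^ k := pow_le_pow_right₀ one_le_two ((card_le_univ _).trans (by simp))
  have h3 : |q a| * |q b| ≤ ∑ j, q j ^ 2 := by
    nlinarith [hle a, hle b, sq_nonneg (|q a| - |q b|)]
  have h0 : 0 ≤ ∏ j ∈ (S.erase a).erase b, |q j| := prod_nonneg fun _ _ => abs_nonneg _
  rw [abs_mul, abs_prod, abs_prod]
  calc (∏ j ∈ S, |q j|) * ∏ j ∈ univ \ S, |p j| ≤ ∏ j ∈ S, |q j| :=
        mul_le_of_le_one_right (prod_nonneg fun _ _ => abs_nonneg _) h1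
    _ = (∏ j ∈ (S.erase a).erase b, |q j|) * (|q a| * |q b|) := by
        rw [← mul_prod_erase S _ ha, ← mul_prod_erase _ _ hb']
        ring
    _ ≤ 2 ^ k * ∑ j, q j ^ 2 := mul_le_mul h2 h3 (by positivity) (by positivity)

section rerandomize

variable {R k : ℕ}

/-- The part of `T_{1-γ} f` that meets `B`, evaluated at one row and multiplied by a function of
the columns off `B`, has mean zero. -/
theorem colExp_onPart_mul_eq_zero {D : Fin R ⊕ Fin R → (Fin k → Bool) → ℝ}
    (hD : ∀ e, UnifMarg (D e)) (γ : ℝ) (f : (Fin R ⊕ Fin R → Bool) → ℝ)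
    (B : Finset (Fin R ⊕ Fin R)) (j : Fin k) {h : (Fin R ⊕ Fin R → Fin k → Bool) → ℝ}
    (hh : DependsOn h ((B : Set (Fin R ⊕ Fin R))ᶜ)) :
    colExp D (fun Z => onPart γ f B (fun e => Z e j) * h Z) = 0 := by
  simp_rw [onPart, sum_mul, colExp_sum, mul_assoc, colExp_const_mul]
  refine sum_eq_zero fun β _ => ?_
  split_ifs with hβ
  · simp
  · obtain ⟨c, hc, hcB⟩ := not_disjoint_iff.1 hβ
    refine mul_eq_zero_of_right _ ?_
    have hfac : ∀ Z : Fin R ⊕ Fin R → Fin k → Bool, chi β (fun e => Z e j) * h Z =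
        (fun z : Fin k → Bool => if z j = true then (-1 : ℝ) else 1) (Z c) *
          (chi (β.erase c) (fun e => Z e j) * h Z) := by
      intro Z
      rw [chi, chi, ← mul_prod_erase β _ hc, mul_assoc]
    simp_rw [hfac]
    refine colExp_mul_eq_zero c _ ((hD c).sum_sign j) fun Z Z' hZ => ?_
    have h1 : h Z = h Z' := hh fun e he => hZ e fun hec => he (by
      rw [Set.mem_singleton_iff] at hec
      rw [hec]
      exact hcB)
    have h2 : chi (β.erase c) (fun e => Z e j) = chi (β.erase c) (fun e => Z' e j) :=
      prod_congr rfl fun e he => by simp only [hZ e (ne_of_mem_erase he)]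
    rw [h1, h2]

theorem offPart_row_dependsOn (γ : ℝ) (f : (Fin R ⊕ Fin R → Bool) → ℝ)
    (B : Finset (Fin R ⊕ Fin R)) (S : Finset (Fin k)) :
    DependsOn (fun Z : Fin R ⊕ Fin R → Fin k → Bool => ∏ j ∈ S, offPart γ f B fun e => Z e j)
      ((B : Set (Fin R ⊕ Fin R))ᶜ) := by
  intro Z Z' hZ
  exact prod_congr rfl fun j _ => offPart_dependsOn γ f B fun e he => by rw [hZ e he]

theorem abs_colExp_noiseT_sub_offPart_le {D : Fin R ⊕ Fin R → (Fin k → Bool) → ℝ}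
    (hD : ∀ e, UnifMarg (D e)) {γ : ℝ} (h0 : 0 < γ) (h1 : γ < 1)
    {f : (Fin R ⊕ Fin R → Bool) → ℝ} (hf : ∀ x, |f x| ≤ 1) (B : Finset (Fin R ⊕ Fin R)) :
    |colExp D (fun Z => ∏ j, noiseT γ f fun e => Z e j) -
        colExp D (fun Z => ∏ j, offPart γ f B fun e => Z e j)| ≤
      2 ^ k * (2 ^ k * (k *
        ∑ β ∈ univ.filter (fun β => ¬Disjoint β B), fhat (noiseT γ f) β ^ 2)) := by
  set I := ∑ β ∈ univ.filter (fun β => ¬Disjoint β B), fhat (noiseT γ f) β ^ 2 with hI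
  have hI0 : 0 ≤ I := sum_nonneg fun _ _ => sq_nonneg _
  let t : Finset (Fin k) → ℝ := fun S => colExp D (fun Z =>
    (∏ j ∈ S, onPart γ f B fun e => Z e j) * ∏ j ∈ univ \ S, offPart γ f B fun e => Z e j)
  have hexp : colExp D (fun Z => ∏ j, noiseT γ f fun e => Z e j) = ∑ S, t S := by
    simp_rw [← onPart_add_offPart γ f B, prod_add, powerset_univ, colExp_sum, t]
  have hempty : t ∅ = colExp D (fun Z => ∏ j, offPart γ f B fun e => Z e j) := by simp [t]
  have hterm : ∀ S ∈ univ.erase ∅, |t S| ≤ 2 ^ k * (k * I) := by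
    intro S hS
    have hSne : S.Nonempty := nonempty_iff_ne_empty.2 (ne_of_mem_erase hS)
    rcases Nat.lt_or_ge 1 S.card with hc | hc
    · refine (abs_colExp_le (fun e => (hD e).nonneg) fun Z => abs_prod_mul_prod_sdiff_le
        (fun j => abs_offPart_le_one h0 h1 hf B _)
        (fun j => abs_onPart_le_two h0 h1 hf B _) hc).trans ?_
      rw [colExp_const_mul, colExp_sum]
      simp_rw [colExp_row hD _ fun x => onPart γ f B x ^ 2]
      have : Fintype.card (Fin R ⊕ Fin R) = 2 * R := by simp [two_mul]
      simp [this, mean_onPart_sq, hI]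
    · obtain ⟨j, rfl⟩ := card_eq_one.1 (le_antisymm hc hSne.card_pos)
      have : t {j} = 0 := by
        simp only [t, prod_singleton]
        exact colExp_onPart_mul_eq_zero hD γ f B j (offPart_row_dependsOn γ f B _)
      rw [this, abs_zero]
      positivity
  rw [hexp, ← hempty, ← add_sum_erase univ t (mem_univ ∅), add_sub_cancel_left]
  refine (abs_sum_le_sum_abs _ _).trans ((sum_le_card_nsmul _ _ _ hterm).trans ?_)
  rw [nsmul_eq_mul]
  refine mul_le_mul_of_nonneg_right ?_ (by positivity)
  calc ((univ.erase (∅ : Finset (Fin k))).card : ℝ)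
      ≤ ((univ : Finset (Finset (Fin k))).card : ℝ) := by
        exact_mod_cast card_le_card (erase_subset _ _)
    _ = 2 ^ k := by simp

theorem abs_colExp_noiseT_sub_le {D D' : Fin R ⊕ Fin R → (Fin k → Bool) → ℝ}
    (hD : ∀ e, UnifMarg (D e)) (hD' : ∀ e, UnifMarg (D' e)) {γ : ℝ} (h0 : 0 < γ) (h1 : γ < 1)
    {f : (Fin R ⊕ Fin R → Bool) → ℝ} (hf : ∀ x, |f x| ≤ 1) (B : Finset (Fin R ⊕ Fin R))
    (hDD' : ∀ e ∉ B, D e = D' e) :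
    |colExp D (fun Z => ∏ j, noiseT γ f fun e => Z e j) -
        colExp D' (fun Z => ∏ j, noiseT γ f fun e => Z e j)| ≤
      2 * 4 ^ k * k * ∑ β ∈ univ.filter (fun β => ¬Disjoint β B), fhat (noiseT γ f) β ^ 2 := by
  have e1 := abs_colExp_noiseT_sub_offPart_le hD h0 h1 hf B
  have e2 := abs_colExp_noiseT_sub_offPart_le hD' h0 h1 hf B
  rw [← colExp_congr_of_dependsOn (fun e => (hD e).sum_eq_one) (fun e => (hD' e).sum_eq_one) B
    hDD' (offPart_row_dependsOn γ f B univ), abs_sub_comm] at e2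
  refine (abs_sub_le _ _ _).trans ((add_le_add e1 e2).trans (le_of_eq ?_))
  rw [show (4 : ℝ) = 2 * 2 by norm_num, mul_pow]
  ring

end rerandomize

/-! ### Covariance of functions with bounded differences -/

theorem sum_fin_succ_fun {C : Type*} [Fintype C] (n : ℕ) (F : (Fin (n + 1) → C) → ℝ) :
    ∑ c, F c = ∑ x : C, ∑ c : Fin n → C, F (Fin.cons x c) := by
  rw [← (Fin.consEquiv fun _ : Fin (n + 1) => C).sum_comp, Fintype.sum_prod_type]
  rfl

theorem abs_cov_le_mul {C : Type*} [Fintype C] {p : C → ℝ} (hp : ∀ x, 0 ≤ p x)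
    (hp1 : ∑ x, p x = 1) {A B : C → ℝ} {a b : ℝ} (hA : ∀ x y, |A x - A y| ≤ a)
    (hB : ∀ x y, |B x - B y| ≤ b) :
    |∑ x, p x * (A x * B x) - (∑ x, p x * A x) * ∑ x, p x * B x| ≤ a * b := by
  have hC : Nonempty C := by
    by_contra hne
    rw [not_nonempty_iff] at hne
    simp at hp1
  obtain ⟨x0⟩ := hC
  have ha : 0 ≤ a := (abs_nonneg _).trans (hA x0 x0)
  have hb : 0 ≤ b := (abs_nonneg _).trans (hB x0 x0)
  have key : ∑ x, p x * (A x * B x) - (∑ x, p x * A x) * ∑ x, p x * B x =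
      (∑ x, ∑ y, p x * p y * ((A x - A y) * (B x - B y))) / 2 := by
    have expand : ∀ x y, p x * p y * ((A x - A y) * (B x - B y)) =
        p x * (A x * B x) * p y + p x * (p y * (A y * B y))
          - p x * A x * (p y * B y) - p x * B x * (p y * A y) := fun x y => by ring
    simp_rw [expand, sum_sub_distrib, sum_add_distrib, ← mul_sum, ← sum_mul, hp1]
    ring
  rw [key, abs_div, abs_two, div_le_iff₀ two_pos]
  calc _ ≤ ∑ x, ∑ y, p x * p y * (a * b) := by
        refine (abs_sum_le_sum_abs _ _).trans (sum_le_sum fun x _ =>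
          (abs_sum_le_sum_abs _ _).trans (sum_le_sum fun y _ => ?_))
        have hpp : 0 ≤ p x * p y := mul_nonneg (hp x) (hp y)
        rw [abs_mul, abs_mul (A x - A y), abs_of_nonneg hpp]
        exact mul_le_mul_of_nonneg_left
          (mul_le_mul (hA x y) (hB x y) (abs_nonneg _) ha) hpp
    _ = a * b := by
        simp_rw [← sum_mul, ← mul_sum, hp1, mul_one, hp1, one_mul]
    _ ≤ a * b * 2 := by nlinarith [mul_nonneg ha hb]

/-- If changing coordinate `i` changes `A` by at most `a i` and `B` by at most `b i`, then the
covariance of `A` and `B` under a product distribution is at most `∑ i, a i * b i`. -/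
theorem abs_cov_le_sum_mul {C : Type*} [Fintype C] {p : C → ℝ} (hp : ∀ x, 0 ≤ p x)
    (hp1 : ∑ x, p x = 1) : ∀ (n : ℕ) {A B : (Fin n → C) → ℝ} {a b : Fin n → ℝ},
    (∀ i c c', (∀ j, j ≠ i → c j = c' j) → |A c - A c'| ≤ a i) →
    (∀ i c c', (∀ j, j ≠ i → c j = c' j) → |B c - B c'| ≤ b i) →
    |∑ c, (∏ i, p (c i)) * (A c * B c) -
      (∑ c, (∏ i, p (c i)) * A c) * ∑ c, (∏ i, p (c i)) * B c| ≤ ∑ i, a i * b i := by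
  intro n
  induction n with
  | zero =>
    intro A B a b _ _
    simp
  | succ n ih =>
    intro A B a b hA hB
    have hw1 : ∑ c : Fin n → C, ∏ i, p (c i) = 1 := by
      rw [← prod_sum_eq_sum_prod fun _ : Fin n => p]
      simp [hp1]
    have hw0 : ∀ c : Fin n → C, 0 ≤ ∏ i, p (c i) := fun c => prod_nonneg fun _ _ => hp _
    have hmean : ∀ {G : (Fin (n + 1) → C) → ℝ} {g : ℝ},
        (∀ c c', (∀ j, j ≠ 0 → c j = c' j) → |G c - G c'| ≤ g) → ∀ x y,
        |∑ c, (∏ i, p (c i)) * G (Fin.cons x c) - ∑ c, (∏ i, p (c i)) * G (Fin.cons y c)| ≤ g := by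
      intro G g hG x y
      rw [← sum_sub_distrib]
      simp_rw [← mul_sub]
      calc _ ≤ ∑ c : Fin n → C, (∏ i, p (c i)) * g := by
            refine (abs_sum_le_sum_abs _ _).trans (sum_le_sum fun c _ => ?_)
            rw [abs_mul, abs_of_nonneg (hw0 c)]
            refine mul_le_mul_of_nonneg_left (hG _ _ fun j hj => ?_) (hw0 c)
            obtain ⟨i, rfl⟩ := Fin.exists_succ_eq.2 hj
            simp
        _ = g := by rw [← sum_mul, hw1, one_mul]
    have htail : ∀ {G : (Fin (n + 1) → C) → ℝ} {g : Fin (n + 1) → ℝ},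
        (∀ i c c', (∀ j, j ≠ i → c j = c' j) → |G c - G c'| ≤ g i) → ∀ (x : C) (i : Fin n) c c',
        (∀ j, j ≠ i → c j = c' j) → |G (Fin.cons x c) - G (Fin.cons x c')| ≤ g i.succ := by
      intro G g hG x i c c' hcc
      refine hG i.succ _ _ fun j hj => ?_
      cases j using Fin.cases with
      | zero => simp
      | succ j => simpa using hcc j fun h => hj (by rw [h])
    have hinner := fun x => ih (htail hA x) (htail hB x)
    have houter := abs_cov_le_mul hp hp1 (hmean (hA 0)) (hmean (hB 0))
    simp_rw [sum_fin_succ_fun, Fin.prod_univ_succ, Fin.cons_zero, Fin.cons_succ, mul_assoc,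
      ← mul_sum]
    set EA := fun x => ∑ c : Fin n → C, (∏ i, p (c i)) * A (Fin.cons x c)
    set EB := fun x => ∑ c : Fin n → C, (∏ i, p (c i)) * B (Fin.cons x c)
    set EAB := fun x => ∑ c : Fin n → C, (∏ i, p (c i)) * (A (Fin.cons x c) * B (Fin.cons x c))
    have hsplit : ∑ x, p x * EAB x - (∑ x, p x * EA x) * ∑ x, p x * EB x =
        ∑ x, p x * (EAB x - EA x * EB x) +
          (∑ x, p x * (EA x * EB x) - (∑ x, p x * EA x) * ∑ x, p x * EB x) := by
      simp_rw [mul_sub, sum_sub_distrib]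
      ring
    rw [hsplit, Fin.sum_univ_succ, add_comm (a 0 * b 0)]
    refine (abs_add_le _ _).trans (add_le_add ?_ houter)
    calc _ ≤ ∑ x, p x * ∑ i : Fin n, a i.succ * b i.succ := by
          refine (abs_sum_le_sum_abs _ _).trans (sum_le_sum fun x _ => ?_)
          rw [abs_mul, abs_of_nonneg (hp x)]
          exact mul_le_mul_of_nonneg_left (hinner x) (hp x)
      _ = _ := by rw [← sum_mul, hp1, one_mul]

/-! ### The test as a mixture of column-independent distributions -/

section mixture

variable {U V : Type} {k L R d : ℕ}

/-- Weight of a choice of the bit `c₁` and of the resampled half of a block (`0` for no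
resampling, `1` for the primed half, `2` for the unprimed half). -/
noncomputable def choiceW (ε : ℝ) (c : Bool × Fin 3) : ℝ :=
  1 / 2 * ![1 - 2 * ε, ε, ε] c.2

/-- Distribution of a column given the choices made for its block. -/
noncomputable def colDist (P0 P1 : (Fin k → Bool) → ℝ) (c : Bool × Fin 3) :
    Fin R ⊕ Fin R → (Fin k → Bool) → ℝ :=
  Sum.elim (fun _ => if c.2 = 2 then fun _ => 1 / 2 ^ k else pick P0 P1 c.1)
    (fun _ => if c.2 = 1 then fun _ => 1 / 2 ^ k else pick P0 P1 c.1)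

/-- The block of `[L]` to which a position of `[2R]` belongs. -/
def blockOf (π : U → V → Fin R → Fin L) (u : U) (v : V) (e : Fin R ⊕ Fin R) : Fin L :=
  π u v (Sum.elim id id e)

theorem choiceW_nonneg {ε : ℝ} (h0 : 0 ≤ ε) (h1 : ε ≤ 1 / 2) (c : Bool × Fin 3) :
    0 ≤ choiceW ε c := by
  obtain ⟨b, m⟩ := c
  fin_cases m <;> simp [choiceW] <;> linarith

theorem sum_choiceW (ε : ℝ) : ∑ c, choiceW ε c = 1 := by
  simp [choiceW, Fintype.sum_prod_type, Fin.sum_univ_three]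
  ring

theorem UnifMarg.uniform : UnifMarg (fun _ : Fin k → Bool => (1 : ℝ) / 2 ^ k) where
  nonneg _ := by positivity
  sum_eq_one := by simp
  marg j b := by
    have key : ∀ b : Bool, (univ.filter fun z : Fin k → Bool => z j = b).card =
        (univ.filter fun z : Fin k → Bool => z j = !b).card := by
      intro b
      refine card_bij' (fun z _ => Function.update z j (!z j))
        (fun z _ => Function.update z j (!z j)) ?_ ?_ ?_ ?_ <;> simp
    have htot : (univ.filter fun z : Fin k → Bool => z j = b).card +
        (univ.filter fun z : Fin k → Bool => z j = !b).card = 2 ^ k := by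
      have := card_filter_add_card_filter_not (s := (univ : Finset (Fin k → Bool)))
        (fun z => z j = b)
      simpa [Bool.eq_not_iff] using this
    rw [← key b] at htot
    have htot' : ((univ.filter fun z : Fin k → Bool => z j = b).card : ℝ) * 2 = 2 ^ k := by
      rw [mul_two]
      exact_mod_cast htot
    rw [sum_const, nsmul_eq_mul, mul_one_div, div_eq_iff (by positivity), ← htot']
    ring

theorem colDist_unifMarg {P0 P1 : (Fin k → Bool) → ℝ} (h0 : UnifMarg P0) (h1 : UnifMarg P1)
    (c : Bool × Fin 3) (e : Fin R ⊕ Fin R) : UnifMarg (colDist P0 P1 c e) := by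
  have hp : UnifMarg (pick P0 P1 c.1) := by
    unfold pick
    split_ifs <;> assumption
  cases e <;> simp only [colDist, Sum.elim_inl, Sum.elim_inr] <;> split_ifs <;>
    first | exact UnifMarg.uniform | exact hp

theorem blockM_eq_sum (π : U → V → Fin R → Fin L) (ε : ℝ) (P0 P1 : (Fin k → Bool) → ℝ) (u : U)
    (v w : V) (i : Fin L) (hv : (fib π u v i).card = d) (hw : (fib π u w i).card = d)
    (X Y : Fin k → Fin R ⊕ Fin R → Bool) :
    blockM π ε P0 P1 d u v w i X Y = ∑ c : Bool × Fin 3, choiceW ε c *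
      ((∏ j ∈ fib π u v i, colDist P0 P1 c (Sum.inl j) (fun r => X r (Sum.inl j)) *
          colDist P0 P1 c (Sum.inr j) (fun r => X r (Sum.inr j))) *
        ∏ j ∈ fib π u w i,
          colDist P0 P1 (!c.1, c.2) (Sum.inl j) (fun r => Y r (Sum.inl j)) *
          colDist P0 P1 (!c.1, c.2) (Sum.inr j) (fun r => Y r (Sum.inr j))) := by
  rw [blockM, Fintype.sum_prod_type, mul_sum]
  refine sum_congr rfl fun b _ => ?_
  rw [Fin.sum_univ_three]
  simp only [choiceW, colDist, Sum.elim_inl, Sum.elim_inr, prod_mul_distrib, prod_const, hv, hw,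
    if_true, show ¬((0 : Fin 3) = 1) by decide, show ¬((0 : Fin 3) = 2) by decide,
    show ¬((1 : Fin 3) = 2) by decide, show ¬((2 : Fin 3) = 1) by decide, if_false,
    Matrix.cons_val]
  ring

theorem prod_fib_eq (π : U → V → Fin R → Fin L) (u : U) (v : V)
    (F : Fin L → Fin R ⊕ Fin R → ℝ) :
    ∏ i, ∏ j ∈ fib π u v i, F i (Sum.inl j) * F i (Sum.inr j) = ∏ e, F (blockOf π u v e) e := by
  rw [Fintype.prod_sum_type, ← prod_mul_distrib,
    ← prod_fiberwise univ (π u v)]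
  exact prod_congr rfl fun i _ => prod_congr rfl fun j hj => by
    simp [blockOf, (mem_filter.1 hj).2]

/-- The conditional expectation, given the choices made for all blocks, of a function of the
columns of one matrix. -/
noncomputable def condExp (π : U → V → Fin R → Fin L) (P0 P1 : (Fin k → Bool) → ℝ) (u : U)
    (v : V) (c : Fin L → Bool × Fin 3) (h : (Fin R ⊕ Fin R → Fin k → Bool) → ℝ) : ℝ :=
  colExp (fun e => colDist P0 P1 (c (blockOf π u v e)) e) h

theorem ET2_mul_eq_sum (π : U → V → Fin R → Fin L) (ε : ℝ) (P0 P1 : (Fin k → Bool) → ℝ) (u : U)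
    (v w : V) (hπ : ∀ v i, (fib π u v i).card = d)
    (g h : (Fin R ⊕ Fin R → Fin k → Bool) → ℝ) :
    ET2 π ε P0 P1 d u v w (fun X Y => g (fun e r => X r e) * h (fun e r => Y r e)) =
      ∑ c : Fin L → Bool × Fin 3, (∏ i, choiceW ε (c i)) *
        (condExp π P0 P1 u v c g *
          condExp π P0 P1 u w (fun i => (!(c i).1, (c i).2)) h) := by
  have hmass : ∀ X Y : Fin k → Fin R ⊕ Fin R → Bool, massT2 π ε P0 P1 d u v w X Y =
      ∑ c : Fin L → Bool × Fin 3, (∏ i, choiceW ε (c i)) *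
        ((∏ e, colDist P0 P1 (c (blockOf π u v e)) e fun r => X r e) *
          ∏ e, colDist P0 P1 (!(c (blockOf π u w e)).1, (c (blockOf π u w e)).2) e
            fun r => Y r e) := by
    intro X Y
    simp_rw [massT2, blockM_eq_sum π ε P0 P1 u v w _ (hπ v _) (hπ w _), prod_sum_eq_sum_prod]
    refine sum_congr rfl fun c _ => ?_
    simp_rw [prod_mul_distrib (s := univ)]
    rw [← prod_fib_eq π u v fun i e => colDist P0 P1 (c i) e fun r => X r e,
      ← prod_fib_eq π u w fun i e => colDist P0 P1 (!(c i).1, (c i).2) e fun r => Y r e]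
  have htr : ∀ F : (Fin R ⊕ Fin R → Fin k → Bool) → ℝ,
      ∑ Z, F Z = ∑ X : Fin k → Fin R ⊕ Fin R → Bool, F fun e r => X r e := fun F =>
    ((Equiv.piComm fun (_ : Fin k) (_ : Fin R ⊕ Fin R) => Bool).sum_comp F).symm
  simp_rw [condExp, colExp, htr, sum_mul_sum, ET2, hmass, sum_mul, mul_sum]
  refine ((sum_congr rfl fun X _ => sum_comm).trans sum_comm).trans ?_
  exact sum_congr rfl fun c _ => sum_congr rfl fun X _ => sum_congr rfl fun Y _ => by ring

theorem condExp_one {P0 P1 : (Fin k → Bool) → ℝ} (h0 : UnifMarg P0) (h1 : UnifMarg P1)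
    (π : U → V → Fin R → Fin L) (u : U) (v : V) (c : Fin L → Bool × Fin 3) :
    condExp π P0 P1 u v c (fun _ => 1) = 1 :=
  colExp_const (fun e => (colDist_unifMarg h0 h1 _ e).sum_eq_one) 1

theorem abs_condExp_le_one {P0 P1 : (Fin k → Bool) → ℝ} (h0 : UnifMarg P0) (h1 : UnifMarg P1)
    (π : U → V → Fin R → Fin L) (u : U) (v : V) (c : Fin L → Bool × Fin 3)
    {g : (Fin R ⊕ Fin R → Fin k → Bool) → ℝ} (hg : ∀ Z, |g Z| ≤ 1) :
    |condExp π P0 P1 u v c g| ≤ 1 :=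
  (abs_colExp_le (fun e => (colDist_unifMarg h0 h1 _ e).nonneg) hg).trans
    (condExp_one h0 h1 π u v c).le

theorem gInf_eq_sum (π : U → V → Fin R → Fin L) (u : U) (v : V)
    (f : (Fin R ⊕ Fin R → Bool) → ℝ) (i : Fin L) :
    gInf π u v f i = ∑ β ∈ univ.filter (fun β : Finset (Fin R ⊕ Fin R) =>
      ¬Disjoint β (univ.filter fun e => blockOf π u v e = i)), fhat f β ^ 2 := by
  rw [gInf]
  congr 1
  ext β
  simp only [ptil, mem_filter, mem_univ, true_and, not_disjoint_iff]
  constructor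
  · rintro ⟨j, hj | hj, hi⟩
    · exact ⟨_, hj, hi⟩
    · exact ⟨_, hj, hi⟩
  · rintro ⟨j | j, hj, hi⟩
    · exact ⟨j, Or.inl hj, hi⟩
    · exact ⟨j, Or.inr hj, hi⟩

theorem gInf_nonneg (π : U → V → Fin R → Fin L) (u : U) (v : V)
    (f : (Fin R ⊕ Fin R → Bool) → ℝ) (i : Fin L) : 0 ≤ gInf π u v f i :=
  sum_nonneg fun _ _ => sq_nonneg _

/-- Changing the choices made for a single block `i` changes the conditional expectation of a
product of `k` copies of `T_{1-γ} f` by at most a constant times the grouped influence of `i`. -/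
theorem abs_condExp_sub_le {P0 P1 : (Fin k → Bool) → ℝ} (h0 : UnifMarg P0) (h1 : UnifMarg P1)
    (π : U → V → Fin R → Fin L) (u : U) (v : V) {γ : ℝ} (hγ0 : 0 < γ) (hγ1 : γ < 1)
    {f : (Fin R ⊕ Fin R → Bool) → ℝ} (hf : ∀ x, |f x| ≤ 1) (i : Fin L)
    {c c' : Fin L → Bool × Fin 3} (hcc : ∀ j, j ≠ i → c j = c' j) :
    |condExp π P0 P1 u v c (fun Z => ∏ j, noiseT γ f fun e => Z e j) -
        condExp π P0 P1 u v c' (fun Z => ∏ j, noiseT γ f fun e => Z e j)| ≤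
      2 * 4 ^ k * k * gInf π u v (noiseT γ f) i := by
  rw [gInf_eq_sum]
  refine abs_colExp_noiseT_sub_le (fun e => colDist_unifMarg h0 h1 _ e)
    (fun e => colDist_unifMarg h0 h1 _ e) hγ0 hγ1 hf _ fun e he => ?_
  rw [hcc _ (by simpa using he)]

variable {P0 P1 : (Fin k → Bool) → ℝ} {ε γ : ℝ}

/-- The gap between the correlated expectation and the product of the marginal expectations. -/
noncomputable def testGap (π : U → V → Fin R → Fin L) (ε : ℝ) (P0 P1 : (Fin k → Bool) → ℝ)
    (d : ℕ) (γ : ℝ) (f : V → (Fin R ⊕ Fin R → Bool) → ℝ) (u : U) (v w : V) : ℝ :=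
  |ET2 π ε P0 P1 d u v w (fun X Y => ∏ j : Fin k, noiseT γ (f v) (X j) * noiseT γ (f w) (Y j))
    - ET2 π ε P0 P1 d u v w (fun X _ => ∏ j : Fin k, noiseT γ (f v) (X j))
      * ET2 π ε P0 P1 d u v w (fun _ Y => ∏ j : Fin k, noiseT γ (f w) (Y j))|

theorem testGap_eq (h0 : UnifMarg P0) (h1 : UnifMarg P1) (π : U → V → Fin R → Fin L)
    (hπ : ∀ u v i, (fib π u v i).card = d) (f : V → (Fin R ⊕ Fin R → Bool) → ℝ) (u : U)
    (v w : V) :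
    testGap π ε P0 P1 d γ f u v w =
      |∑ c : Fin L → Bool × Fin 3, (∏ i, choiceW ε (c i)) *
          (condExp π P0 P1 u v c (fun Z => ∏ j, noiseT γ (f v) fun e => Z e j) *
            condExp π P0 P1 u w (fun i => (!(c i).1, (c i).2))
              (fun Z => ∏ j, noiseT γ (f w) fun e => Z e j)) -
        (∑ c : Fin L → Bool × Fin 3, (∏ i, choiceW ε (c i)) *
          condExp π P0 P1 u v c (fun Z => ∏ j, noiseT γ (f v) fun e => Z e j)) *
        ∑ c : Fin L → Bool × Fin 3, (∏ i, choiceW ε (c i)) *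
          condExp π P0 P1 u w (fun i => (!(c i).1, (c i).2))
            (fun Z => ∏ j, noiseT γ (f w) fun e => Z e j)| := by
  have e1 := ET2_mul_eq_sum π ε P0 P1 u v w (hπ u)
    (fun Z => ∏ j, noiseT γ (f v) fun e => Z e j) (fun Z => ∏ j, noiseT γ (f w) fun e => Z e j)
  have e2 := ET2_mul_eq_sum π ε P0 P1 u v w (hπ u)
    (fun Z => ∏ j, noiseT γ (f v) fun e => Z e j) (fun _ => 1)
  have e3 := ET2_mul_eq_sum π ε P0 P1 u v w (hπ u)
    (fun _ => 1) (fun Z => ∏ j, noiseT γ (f w) fun e => Z e j)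
  simp only [condExp_one h0 h1, mul_one, one_mul] at e2 e3
  rw [testGap, ← e1, ← e2, ← e3]
  simp_rw [prod_mul_distrib]

theorem testGap_le_two (h0 : UnifMarg P0) (h1 : UnifMarg P1) (hε0 : 0 < ε) (hε1 : ε ≤ 1 / 2)
    (hγ0 : 0 < γ) (hγ1 : γ < 1) (π : U → V → Fin R → Fin L)
    (hπ : ∀ u v i, (fib π u v i).card = d) {f : V → (Fin R ⊕ Fin R → Bool) → ℝ}
    (hf : ∀ v x, |f v x| ≤ 1) (u : U) (v w : V) : testGap π ε P0 P1 d γ f u v w ≤ 2 := by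
  rw [testGap_eq h0 h1 π hπ]
  have hprod : ∀ (v : V) (Z : Fin R ⊕ Fin R → Fin k → Bool),
      |∏ j, noiseT γ (f v) fun e => Z e j| ≤ 1 := by
    intro v Z
    rw [abs_prod]
    exact prod_le_one (fun _ _ => abs_nonneg _) fun j _ => abs_noiseT_le_one hγ0 hγ1 (hf v) _
  have hmean : ∀ G : (Fin L → Bool × Fin 3) → ℝ, (∀ c, |G c| ≤ 1) →
      |∑ c, (∏ i, choiceW ε (c i)) * G c| ≤ 1 := by
    intro G hG
    calc _ ≤ ∑ c : Fin L → Bool × Fin 3, ∏ i, choiceW ε (c i) := by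
          refine (abs_sum_le_sum_abs _ _).trans (sum_le_sum fun c _ => ?_)
          have hw : 0 ≤ ∏ i, choiceW ε (c i) :=
            prod_nonneg fun _ _ => choiceW_nonneg hε0.le hε1 _
          rw [abs_mul, abs_of_nonneg hw]
          exact mul_le_of_le_one_right hw (hG c)
      _ = 1 := by
          rw [← prod_sum_eq_sum_prod fun _ : Fin L => choiceW ε]
          simp [sum_choiceW]
  have hA := fun c => abs_condExp_le_one h0 h1 π u v c (hprod v)
  have hB := fun c : Fin L → Bool × Fin 3 =>
    abs_condExp_le_one h0 h1 π u w (fun i => (!(c i).1, (c i).2)) (hprod w)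
  refine (abs_sub _ _).trans ?_
  rw [abs_mul, ← one_add_one_eq_two]
  refine add_le_add (hmean _ fun c => ?_)
    (mul_le_one₀ (hmean _ hA) (abs_nonneg _) (hmean _ hB))
  rw [abs_mul]
  exact mul_le_one₀ (hA c) (abs_nonneg _) (hB c)

theorem testGap_le_sum_gInf (h0 : UnifMarg P0) (h1 : UnifMarg P1) (hε0 : 0 < ε)
    (hε1 : ε ≤ 1 / 2) (hγ0 : 0 < γ) (hγ1 : γ < 1) (π : U → V → Fin R → Fin L)
    (hπ : ∀ u v i, (fib π u v i).card = d) {f : V → (Fin R ⊕ Fin R → Bool) → ℝ}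
    (hf : ∀ v x, |f v x| ≤ 1) (u : U) (v w : V) :
    testGap π ε P0 P1 d γ f u v w ≤ (2 * 4 ^ k * k) ^ 2 *
      ∑ i, gInf π u v (noiseT γ (f v)) i * gInf π u w (noiseT γ (f w)) i := by
  rw [testGap_eq h0 h1 π hπ]
  refine (abs_cov_le_sum_mul (choiceW_nonneg hε0.le hε1) (sum_choiceW ε) L
    (fun i c c' hcc => abs_condExp_sub_le h0 h1 π u v hγ0 hγ1 (hf v) i hcc)
    (fun i c c' hcc => abs_condExp_sub_le h0 h1 π u w hγ0 hγ1 (hf w) i fun j hj => by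
      rw [hcc j hj])).trans (le_of_eq ?_)
  rw [mul_sum]
  exact sum_congr rfl fun i _ => by ring

end mixture

section Euvw

variable {U V : Type} [Fintype U] [Fintype V] {Adj : U → V → Bool}

theorem Euvw_mono {g h : U → V → V → ℝ} (hgh : ∀ u v w, g u v w ≤ h u v w) :
    Euvw Adj g ≤ Euvw Adj h := by
  unfold Euvw
  gcongr
  exact hgh _ _ _

theorem Euvw_const_mul (c : ℝ) (h : U → V → V → ℝ) :
    Euvw Adj (fun u v w => c * h u v w) = c * Euvw Adj h := by
  simp only [Euvw, mul_sum]
  exact sum_congr rfl fun _ _ => sum_congr rfl fun _ _ => sum_congr rfl fun _ _ => by ring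

theorem Euvw_const [Nonempty U] (hAdj : ∀ u, 0 < (nbr Adj u).card) (c : ℝ) :
    Euvw Adj (fun _ _ _ => c) = c := by
  have h : ∀ u : U, 1 / ((nbr Adj u).card : ℝ) ^ 2 *
      ∑ v ∈ nbr Adj u, ∑ w ∈ nbr Adj u, c = c := by
    intro u
    have : ((nbr Adj u).card : ℝ) ≠ 0 := by exact_mod_cast (hAdj u).ne'
    simp only [sum_const, nsmul_eq_mul]
    field_simp
  rw [Euvw, sum_congr rfl fun u _ => h u, sum_const, nsmul_eq_mul, card_univ]
  have : (Fintype.card U : ℝ) ≠ 0 := by exact_mod_cast Fintype.card_ne_zero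
  field_simp

end Euvw

/-- invariance step: for every `k` there is a constant `C_k > 0` such that in
the setting of the long code test `𝒯₂`, for every `γ ∈ (0,1)` and every family of
`±1`-valued tables `f_v`, with `τ_{u,v,w} := Σ_i Inf̄ᵘ_i[T_{1-γ}f_v]·Inf̄ᵘ_i[T_{1-γ}f_w]`,
the expected (over `u, v, w`) absolute difference between the correlated and the
product-of-marginals expectations of `Π_j (T_{1-γ}f_v)(x_j)(T_{1-γ}f_w)(y_j)` is at most
`C_k · √(E_{u,v,w}[τ_{u,v,w}]/γ)`. -/
theorem stmt_12 :
    ∀ k : ℕ, 2 ≤ k → ∃ Ck : ℝ, 0 < Ck ∧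
      ∀ (L R d : ℕ), 0 < d → R = d * L →
      ∀ (U V : Type) [Fintype U] [Fintype V] [Nonempty U] [Nonempty V]
        (Adj : U → V → Bool) (π : U → V → Fin R → Fin L)
        (dU dV : ℕ), 0 < dU → 0 < dV →
        (∀ u : U, (nbr Adj u).card = dU) →
        (∀ v : V, (univ.filter (fun u : U => Adj u v = true)).card = dV) →
        (∀ (u : U) (v : V) (i : Fin L), (fib π u v i).card = d) →
      ∀ (ε : ℝ), 0 < ε → ε ≤ 1 / 2 →
      ∀ (P0 P1 : (Fin k → Bool) → ℝ),
        (∀ x, 0 ≤ P0 x) → (∀ x, 0 ≤ P1 x) →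
        (∑ x, P0 x = 1) → (∑ x, P1 x = 1) →
        (∀ (j : Fin k) (b : Bool),
          ∑ x ∈ univ.filter (fun x : Fin k → Bool => x j = b), P0 x = 1 / 2) →
        (∀ (j : Fin k) (b : Bool),
          ∑ x ∈ univ.filter (fun x : Fin k → Bool => x j = b), P1 x = 1 / 2) →
        (∀ x : Fin k → Bool, P0 x ≠ 0 → Even (univ.filter (fun i => x i = true)).card) →
        (∀ x : Fin k → Bool, P1 x ≠ 0 → Odd (univ.filter (fun i => x i = true)).card) →
      ∀ (γ : ℝ), 0 < γ → γ < 1 →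
      ∀ f : V → ((Fin R ⊕ Fin R) → Bool) → ℝ,
        (∀ v x, f v x = 1 ∨ f v x = -1) →
        Euvw Adj (fun u v w =>
            |ET2 π ε P0 P1 d u v w
                (fun X Y => ∏ j : Fin k, noiseT γ (f v) (X j) * noiseT γ (f w) (Y j))
              - ET2 π ε P0 P1 d u v w (fun X _ => ∏ j : Fin k, noiseT γ (f v) (X j))
                * ET2 π ε P0 P1 d u v w (fun _ Y => ∏ j : Fin k, noiseT γ (f w) (Y j))|)
          ≤ Ck * Real.sqrt
              (Euvw Adj (fun u v w =>
                  ∑ i : Fin L, gInf π u v (noiseT γ (f v)) i * gInf π u w (noiseT γ (f w)) i)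
                / γ) := by
  intro k hk
  refine ⟨√(2 * (2 * 4 ^ k * k) ^ 2), Real.sqrt_pos.2 (by positivity), ?_⟩
  intro L R d _ _ U V _ _ _ _ Adj π dU dV hdU _ hU _ hπ ε hε0 hε1 P0 P1 hP0 hP1 hs0 hs1 hm0 hm1
    _ _ γ hγ0 hγ1 f hf
  have h0 : UnifMarg P0 := ⟨hP0, hs0, hm0⟩
  have h1 : UnifMarg P1 := ⟨hP1, hs1, hm1⟩
  have hf' : ∀ v x, |f v x| ≤ 1 := fun v x => by rcases hf v x with h | h <;> simp [h]
  have hAdj : ∀ u, 0 < (nbr Adj u).card := fun u => by rw [hU u]; exact hdU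
  change Euvw Adj (testGap π ε P0 P1 d γ f) ≤ _
  set τ : U → V → V → ℝ := fun u v w =>
    ∑ i : Fin L, gInf π u v (noiseT γ (f v)) i * gInf π u w (noiseT γ (f w)) i with hτ
  set E := Euvw Adj (testGap π ε P0 P1 d γ f) with hE
  have hE0 : 0 ≤ E := by
    rw [← Euvw_const hAdj 0]
    exact Euvw_mono fun u v w => abs_nonneg _
  have hT0 : 0 ≤ Euvw Adj τ := by
    rw [← Euvw_const hAdj 0]
    exact Euvw_mono fun u v w => sum_nonneg fun i _ =>
      mul_nonneg (gInf_nonneg ..) (gInf_nonneg ..)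
  have hE2 : E ≤ 2 := by
    rw [← Euvw_const hAdj 2]
    exact Euvw_mono fun u v w => testGap_le_two h0 h1 hε0 hε1 hγ0 hγ1 π hπ hf' u v w
  have hET : E ≤ (2 * 4 ^ k * k) ^ 2 * Euvw Adj τ := by
    rw [← Euvw_const_mul]
    exact Euvw_mono fun u v w => testGap_le_sum_gInf h0 h1 hε0 hε1 hγ0 hγ1 π hπ hf' u v w
  rw [← Real.sqrt_mul (by positivity)]
  refine Real.le_sqrt_of_sq_le ?_
  calc E ^ 2 = E * E := sq E
    _ ≤ 2 * ((2 * 4 ^ k * k) ^ 2 * Euvw Adj τ) := mul_le_mul hE2 hET hE0 zero_le_two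
    _ ≤ 2 * ((2 * 4 ^ k * k) ^ 2 * (Euvw Adj τ / γ)) := by
        gcongr
        exact le_div_self hT0 hγ0 hγ1.le
    _ = _ := by ring
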